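/- arXiv:2206.00728 — 3 statements merged into one kernel-verified Lean document; each statement's English description precedes it below -/
import Mathlib

section
/- Fix d ≥ 1 and −d/2 < s < 0. There exists a constant C > 0, depending only on d and s, such that for all real R ≥ 1, A ≥ 1, all N ≥ 8A, and all t ≥ 0, the second Picard iterate satisfies the upper bound ‖Ξ₁(t)‖_{H^s} ≤ C t² R³ A^{2d} A^{d/2+s}. -/
open scoped BigOperators

noncomputable section

/-- Japanese bracket `⟨n⟩ = √(1+|n|²)` for `n ∈ ℤ^d`. -/
def jap {d : ℕ} (n : Fin d → ℤ) : ℝ := Real.sqrt (1 + ∑ i, ((n i : ℝ)) ^ 2)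

/-- Discrete convolution on `ℤ^d`. -/
def dconv {d : ℕ} (f g : (Fin d → ℤ) → ℂ) : (Fin d → ℤ) → ℂ :=
  fun n => ∑' m, f m * g (n - m)

/-- Triple (cubic) convolution. -/
def dcube {d : ℕ} (f : (Fin d → ℤ) → ℂ) : (Fin d → ℤ) → ℂ := dconv (dconv f f) f

/-- The square of the `H^σ` norm of a sequence of Fourier coefficients. -/
def hsum {d : ℕ} (σ : ℝ) (v : (Fin d → ℤ) → ℂ) : ℝ :=
  ∑' n, (jap n) ^ (2 * σ) * ‖v n‖ ^ 2

/-- `m ∈ Q_A = [-A/2, A/2)^d`. -/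
def inQ {d : ℕ} (A : ℝ) (m : Fin d → ℤ) : Prop :=
  ∀ i, -(A / 2) ≤ (m i : ℝ) ∧ (m i : ℝ) < A / 2

/-- The first standard basis vector `e₁ = (1,0,…,0)` of `ℤ^d`. -/
def e1 (d : ℕ) : Fin d → ℤ := fun i => if (i : ℕ) = 0 then 1 else 0

/-- The initial datum `φ₀` with amplitude `R`, supported on the four cubes
`jNe₁ + Q_A`, `j ∈ {-2,-1,1,2}`. -/
def phi0 {d : ℕ} (R A : ℝ) (N : ℤ) : (Fin d → ℤ) → ℂ :=
  Set.indicator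
    {n : Fin d → ℤ | ∃ j : ℤ, (j = -2 ∨ j = -1 ∨ j = 1 ∨ j = 2) ∧
      inQ A (fun i => n i - j * N * e1 d i)}
    (fun _ => (R : ℂ))

/-- The free wave evolution of the data `(φ₀, φ₁) = (φ₀, N·φ₀)`. -/
def zfree {d : ℕ} (R A : ℝ) (N : ℤ) (t : ℝ) : (Fin d → ℤ) → ℂ :=
  fun n => (Real.cos (t * jap n) : ℂ) * phi0 R A N n
    + ((Real.sin (t * jap n) / jap n : ℝ) : ℂ) * ((N : ℂ) * phi0 R A N n)

/-- The second Picard iterate `Ξ₁`. -/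
def Xi1 {d : ℕ} (R A : ℝ) (N : ℤ) (t : ℝ) : (Fin d → ℤ) → ℂ :=
  fun n => -∫ s in (0 : ℝ)..t,
    ((Real.sin ((t - s) * jap n) / jap n : ℝ) : ℂ) * dcube (zfree R A N s) n

end

theorem one_le_jap {d : ℕ} (n : Fin d → ℤ) : 1 ≤ jap n := by
  rw [jap, Real.one_le_sqrt]
  have : 0 ≤ ∑ i, ((n i : ℝ)) ^ 2 := by positivity
  linarith

theorem jap_pos {d : ℕ} (n : Fin d → ℤ) : 0 < jap n :=
  one_pos.trans_le (one_le_jap n)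

theorem sqrt_one_add_sq_le_jap {d : ℕ} (n : Fin d → ℤ) (i : Fin d) :
    Real.sqrt (1 + (n i : ℝ) ^ 2) ≤ jap n := by
  apply Real.sqrt_le_sqrt
  have := Finset.single_le_sum (f := fun i => (n i : ℝ) ^ 2) (fun _ _ => sq_nonneg _)
    (Finset.mem_univ i)
  linarith

theorem abs_le_sqrt_one_add_sq (x : ℝ) : |x| ≤ Real.sqrt (1 + x ^ 2) :=
  Real.abs_le_sqrt (by linarith)

theorem abs_le_jap {d : ℕ} (n : Fin d → ℤ) (i : Fin d) : |(n i : ℝ)| ≤ jap n :=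
  (abs_le_sqrt_one_add_sq _).trans (sqrt_one_add_sq_le_jap n i)

theorem norm_dconv_le {d : ℕ} {f g : (Fin d → ℤ) → ℂ} {a b : ℝ} {F : Finset (Fin d → ℤ)}
    (hf : ∀ n, ‖f n‖ ≤ a) (hg : ∀ n, ‖g n‖ ≤ b) (hF : ∀ n, g n ≠ 0 → n ∈ F) (n : Fin d → ℤ) :
    ‖dconv f g n‖ ≤ F.card * (a * b) := by
  classical
  have ha : 0 ≤ a := (norm_nonneg _).trans (hf 0)
  unfold dconv
  rw [tsum_eq_sum (s := F.image (fun m => n - m))]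
  · refine (norm_sum_le_of_le _ (f := fun m => f m * g (n - m)) (n := fun _ => a * b)
      fun m _ => ?_).trans ?_
    · rw [norm_mul]
      exact mul_le_mul (hf m) (hg _) (norm_nonneg _) ha
    · rw [Finset.sum_const, nsmul_eq_mul]
      refine mul_le_mul_of_nonneg_right ?_ (mul_nonneg ha ((norm_nonneg _).trans (hg 0)))
      exact_mod_cast Finset.card_image_le
  · intro m hm
    by_contra h
    exact hm (Finset.mem_image.2 ⟨n - m, hF _ (right_ne_zero_of_mul h), by abel⟩)

theorem exists_of_dconv_ne_zero {d : ℕ} {f g : (Fin d → ℤ) → ℂ} {n : Fin d → ℤ}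
    (h : dconv f g n ≠ 0) : ∃ m k, m + k = n ∧ f m ≠ 0 ∧ g k ≠ 0 := by
  by_contra! H
  refine h ?_
  have h_zero : ∀ m, f m * g (n - m) = 0 := fun m => by
    by_cases hm : f m = 0
    · simp [hm]
    · simp [H m (n - m) (by abel) hm]
  simp [dconv, h_zero]

/-- The cube of integer points with all coordinates in `[-M, M]`. -/
noncomputable def intCube (d M : ℕ) : Finset (Fin d → ℤ) :=
  Fintype.piFinset fun _ => Finset.Icc (-(M : ℤ)) M

theorem card_intCube (d M : ℕ) : (intCube d M).card = (2 * M + 1) ^ d := by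
  rw [intCube, Fintype.card_piFinset_const, Int.card_Icc]
  congr 1
  omega

/-- The union of the cubes `jNe₁ + [-M, M]^d` over `|j| ≤ J`. -/
noncomputable def shiftedCubes (d : ℕ) (J : ℕ) (N : ℤ) (M : ℕ) : Finset (Fin d → ℤ) :=
  (Finset.Icc (-(J : ℤ)) J ×ˢ intCube d M).image fun p => p.2 + (p.1 * N) • e1 d

theorem card_shiftedCubes_le (d J : ℕ) (N : ℤ) (M : ℕ) :
    (shiftedCubes d J N M).card ≤ (2 * J + 1) * (2 * M + 1) ^ d := by
  refine Finset.card_image_le.trans ?_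
  rw [Finset.card_product, card_intCube, Int.card_Icc]
  refine Nat.mul_le_mul_right _ ?_
  omega

theorem mem_shiftedCubes {d J : ℕ} {N : ℤ} {M : ℕ} {n : Fin d → ℤ} (j : ℤ) (hj : |j| ≤ J)
    (h : ∀ i, |n i - j * N * e1 d i| ≤ M) : n ∈ shiftedCubes d J N M := by
  refine Finset.mem_image.2 ⟨(j, n - (j * N) • e1 d), ?_, by simp⟩
  simp only [Finset.mem_product, intCube, Fintype.mem_piFinset, Finset.mem_Icc, ← abs_le]
  exact ⟨hj, h⟩

theorem sum_image_le_sum {ι κ : Type*} [DecidableEq κ] (s : Finset ι) (g : ι → κ) (f : κ → ℝ)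
    (hf : ∀ x, 0 ≤ f x) : ∑ x ∈ s.image g, f x ≤ ∑ y ∈ s, f (g y) := by
  rw [← Finset.sum_fiberwise_of_maps_to (fun y hy => Finset.mem_image_of_mem g hy)]
  refine Finset.sum_le_sum fun x hx => ?_
  obtain ⟨y, hy, rfl⟩ := Finset.mem_image.1 hx
  exact Finset.single_le_sum (f := fun y => f (g y)) (fun _ _ => hf _)
    (Finset.mem_filter.2 ⟨hy, rfl⟩)

theorem rpow_sub_one_le_sub {b : ℝ} (hb0 : 0 < b) (hb1 : b ≤ 1) {x : ℝ} (hx : 1 ≤ x) :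
    x ^ (b - 1) ≤ (x ^ b - (x - 1) ^ b) / b := by
  have hx0 : 0 < x := by linarith
  have h := rpow_one_add_le_one_add_mul_self (s := -x⁻¹)
    (neg_le_neg (inv_le_one_of_one_le₀ hx)) hb0.le hb1
  have hsplit : (x - 1) ^ b = x ^ b * (1 + -x⁻¹) ^ b := by
    rw [← Real.mul_rpow hx0.le (by linarith [inv_le_one_of_one_le₀ hx])]
    congr 1
    field_simp
    ring
  rw [le_div_iff₀ hb0, hsplit, Real.rpow_sub_one hx0.ne']
  have := mul_le_mul_of_nonneg_left h (Real.rpow_nonneg hx0.le b)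
  calc x ^ b / x * b = x ^ b - x ^ b * (1 + b * -x⁻¹) := by ring
    _ ≤ _ := by linarith

theorem sum_Icc_sqrt_rpow_le {a : ℝ} (ha0 : -1 < a) (ha1 : a ≤ 0) (M : ℕ) :
    ∑ k ∈ Finset.Icc (-(M : ℤ)) M, Real.sqrt (1 + (k : ℝ) ^ 2) ^ a
      ≤ 1 + 2 * ((M : ℝ) ^ (1 + a) / (1 + a)) := by
  induction M with
  | zero => simp [Real.zero_rpow (by linarith : 1 + a ≠ 0)]
  | succ M ih =>
    have hIcc : Finset.Icc (-((M + 1 : ℕ) : ℤ)) ((M + 1 : ℕ) : ℤ) =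
        insert ((M : ℤ) + 1) (insert (-((M : ℤ) + 1)) (Finset.Icc (-(M : ℤ)) M)) := by
      ext k
      simp only [Finset.mem_Icc, Finset.mem_insert]
      omega
    rw [hIcc, Finset.sum_insert (by simp only [Finset.mem_Icc, Finset.mem_insert]; omega),
      Finset.sum_insert (by simp only [Finset.mem_Icc]; omega)]
    have hterm : Real.sqrt (1 + ((M : ℝ) + 1) ^ 2) ^ a ≤ ((M : ℝ) + 1) ^ a := by
      refine Real.rpow_le_rpow_of_nonpos (by positivity) ?_ ha1
      exact (le_abs_self _).trans (abs_le_sqrt_one_add_sq _)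
    have hstep := rpow_sub_one_le_sub (b := 1 + a) (by linarith) (by linarith)
      (x := (M : ℝ) + 1) (by linarith [M.cast_nonneg (α := ℝ)])
    rw [add_sub_cancel_left, add_sub_cancel_right, sub_div] at hstep
    push_cast
    rw [neg_sq]
    linarith

theorem sum_intCube_jap_rpow_le {d : ℕ} (hd : 1 ≤ d) {s : ℝ} (hs1 : -(d : ℝ) / 2 < s)
    (hs2 : s < 0) {A : ℝ} (hA : 1 ≤ A) {M : ℕ} (hM : (M : ℝ) ≤ 2 * A) :
    ∑ m ∈ intCube d M, jap m ^ (2 * s)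
      ≤ (1 + 2 * (2 ^ (1 + 2 * s / d) / (1 + 2 * s / d))) ^ d * A ^ ((d : ℝ) + 2 * s) := by
  have hd0 : (0 : ℝ) < d := by exact_mod_cast hd
  set a : ℝ := 2 * s / d with ha
  have had : a * d = 2 * s := by rw [ha]; field_simp
  have ha0 : -1 < a := by rw [ha, lt_div_iff₀ hd0]; linarith
  have ha1 : a ≤ 0 := div_nonpos_of_nonpos_of_nonneg (by linarith) hd0.le
  have hone : (0 : ℝ) < 1 + a := by linarith
  calc ∑ m ∈ intCube d M, jap m ^ (2 * s)
      ≤ ∑ m ∈ intCube d M, ∏ i, Real.sqrt (1 + (m i : ℝ) ^ 2) ^ a := by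
        refine Finset.sum_le_sum fun m _ => ?_
        have : jap m ^ (2 * s) = ∏ _i : Fin d, jap m ^ a := by
          rw [Finset.prod_const, Finset.card_univ, Fintype.card_fin, ← Real.rpow_mul_natCast
            (jap_pos m).le, had]
        rw [this]
        exact Finset.prod_le_prod (fun i _ => Real.rpow_nonneg (jap_pos m).le _) fun i _ =>
          Real.rpow_le_rpow_of_nonpos (by positivity) (sqrt_one_add_sq_le_jap m i) ha1
    _ = (∑ k ∈ Finset.Icc (-(M : ℤ)) M, Real.sqrt (1 + (k : ℝ) ^ 2) ^ a) ^ d := by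
        rw [Finset.sum_pow', intCube]
    _ ≤ ((1 + 2 * (2 ^ (1 + a) / (1 + a))) * A ^ (1 + a)) ^ d := by
        refine pow_le_pow_left₀ (by positivity) ((sum_Icc_sqrt_rpow_le ha0 ha1 M).trans ?_) d
        have h1 : (1 : ℝ) ≤ A ^ (1 + a) := Real.one_le_rpow hA hone.le
        have h2 : (M : ℝ) ^ (1 + a) ≤ 2 ^ (1 + a) * A ^ (1 + a) := by
          rw [← Real.mul_rpow zero_le_two (by linarith)]
          exact Real.rpow_le_rpow M.cast_nonneg hM hone.le
        calc 1 + 2 * ((M : ℝ) ^ (1 + a) / (1 + a))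
            ≤ A ^ (1 + a) + 2 * (2 ^ (1 + a) * A ^ (1 + a) / (1 + a)) := by gcongr
          _ = _ := by ring
    _ = _ := by
        rw [mul_pow, ← Real.rpow_mul_natCast (by linarith)]
        congr 2
        rw [add_mul, had, one_mul]

theorem sum_intCube_shift_jap_rpow_le {d : ℕ} (hd : 1 ≤ d) {s : ℝ} (hs2 : s < 0) {A : ℝ}
    (hA : 1 ≤ A) {N : ℤ} (hN : 8 * A ≤ N) {M : ℕ} (hM : (M : ℝ) ≤ 3 * A / 2) {j : ℤ}
    (hj : j ≠ 0) :
    ∑ m ∈ intCube d M, jap (m + (j * N) • e1 d) ^ (2 * s)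
      ≤ 4 ^ d * A ^ ((d : ℝ) + 2 * s) := by
  have hA0 : 0 < A := by linarith
  have hterm : ∀ m ∈ intCube d M, jap (m + (j * N) • e1 d) ^ (2 * s) ≤ A ^ (2 * s) := by
    intro m hm
    refine Real.rpow_le_rpow_of_nonpos hA0 ?_ (by linarith)
    refine le_trans ?_ (abs_le_jap _ ⟨0, hd⟩)
    have hm0 : |(m ⟨0, hd⟩ : ℝ)| ≤ M := by
      have := Fintype.mem_piFinset.1 hm ⟨0, hd⟩
      rw [Finset.mem_Icc, ← abs_le] at this
      exact_mod_cast this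
    have hj1 : (1 : ℝ) ≤ |(j : ℝ)| := by exact_mod_cast Int.one_le_abs hj
    have hjN : 8 * A ≤ |(j : ℝ) * N| := by
      rw [abs_mul]
      have hN' := hN.trans (le_abs_self (N : ℝ))
      nlinarith
    have htri := abs_sub_abs_le_abs_sub ((j : ℝ) * N) (-(m ⟨0, hd⟩ : ℝ))
    rw [abs_neg, sub_neg_eq_add, add_comm ((j : ℝ) * N)] at htri
    simp only [Pi.add_apply, Pi.smul_apply, e1, smul_eq_mul, if_true, mul_one, Int.cast_add,
      Int.cast_mul]
    linarith
  refine (Finset.sum_le_sum hterm).trans ?_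
  rw [Finset.sum_const, card_intCube, nsmul_eq_mul, Real.rpow_add hA0, Real.rpow_natCast,
    ← mul_assoc, ← mul_pow]
  gcongr
  push_cast
  gcongr
  linarith

theorem sum_shiftedCubes_jap_rpow_le {d : ℕ} (hd : 1 ≤ d) {s : ℝ} (hs1 : -(d : ℝ) / 2 < s)
    (hs2 : s < 0) {A : ℝ} (hA : 1 ≤ A) {N : ℤ} (hN : 8 * A ≤ N) {M : ℕ}
    (hM : (M : ℝ) ≤ 3 * A / 2) (J : ℕ) :
    ∑ n ∈ shiftedCubes d J N M, jap n ^ (2 * s)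
      ≤ (2 * J + 1) * ((1 + 2 * (2 ^ (1 + 2 * s / d) / (1 + 2 * s / d))) ^ d + 4 ^ d)
        * A ^ ((d : ℝ) + 2 * s) := by
  have hd0 : (0 : ℝ) < d := by exact_mod_cast hd
  have ha : 0 < 1 + 2 * s / d := by
    have : -1 < 2 * s / d := by rw [lt_div_iff₀ hd0]; linarith
    linarith
  refine (sum_image_le_sum _ _ _ fun x => Real.rpow_nonneg (jap_pos x).le _).trans ?_
  rw [Finset.sum_product]
  refine (Finset.sum_le_card_nsmul _ _ (((1 + 2 * (2 ^ (1 + 2 * s / d) / (1 + 2 * s / d))) ^ d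
    + 4 ^ d) * A ^ ((d : ℝ) + 2 * s)) fun j _ => ?_).trans_eq ?_
  · rw [add_mul]
    have hApos : 0 ≤ A ^ ((d : ℝ) + 2 * s) := Real.rpow_nonneg (by linarith) _
    by_cases hj : j = 0
    · subst hj
      simp only [zero_mul, zero_smul, add_zero]
      refine (sum_intCube_jap_rpow_le hd hs1 hs2 hA (by linarith)).trans ?_
      exact le_add_of_nonneg_right (by positivity)
    · refine (sum_intCube_shift_jap_rpow_le hd hs2 hA hN hM hj).trans ?_
      exact le_add_of_nonneg_left (by positivity)
  · rw [Int.card_Icc, nsmul_eq_mul, mul_assoc]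
    congr 1
    have : ((J : ℤ) + 1 - -(J : ℤ)).toNat = 2 * J + 1 := by omega
    rw [this]
    push_cast
    rfl

theorem exists_of_phi0_ne_zero {d : ℕ} {R A : ℝ} {N : ℤ} {n : Fin d → ℤ}
    (h : phi0 R A N n ≠ 0) : ∃ j : ℤ, 1 ≤ |j| ∧ |j| ≤ 2 ∧
      ∀ i, |((n i - j * N * e1 d i : ℤ) : ℝ)| ≤ A / 2 := by
  obtain ⟨j, hj, hQ⟩ := Set.mem_of_indicator_ne_zero h
  refine ⟨j, ?_, ?_, fun i => abs_le.2 ⟨(hQ i).1, (hQ i).2.le⟩⟩ <;>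
    rcases hj with rfl | rfl | rfl | rfl <;> norm_num

theorem phi0_ne_zero_of_zfree_ne_zero {d : ℕ} {R A : ℝ} {N : ℤ} {t : ℝ} {n : Fin d → ℤ}
    (h : zfree R A N t n ≠ 0) : phi0 R A N n ≠ 0 := by
  contrapose! h
  simp [zfree, h]

theorem norm_zfree_le {d : ℕ} (hd : 1 ≤ d) {R A : ℝ} (hR : 0 ≤ R) (hA : 1 ≤ A) {N : ℤ}
    (hN : 8 * A ≤ N) (t : ℝ) (n : Fin d → ℤ) : ‖zfree R A N t n‖ ≤ 3 * R := by
  by_cases h : phi0 R A N n = 0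
  · simp [zfree, h, hR]
  obtain ⟨j, hj, -, hQ⟩ := exists_of_phi0_ne_zero h
  have hphi : ‖phi0 R A N n‖ ≤ R := by
    refine (norm_indicator_le_norm_self _ _).trans ?_
    simp [abs_of_nonneg hR]
  have hNpos : (0 : ℝ) < N := by linarith
  have hjap : (N : ℝ) ≤ 2 * jap n := by
    have h0 := hQ ⟨0, hd⟩
    simp only [e1, if_true, mul_one] at h0
    push_cast at h0
    have hjN : (N : ℝ) ≤ |(j : ℝ) * N| := by
      rw [abs_mul, abs_of_pos hNpos]
      have : (1 : ℝ) ≤ |(j : ℝ)| := by exact_mod_cast hj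
      nlinarith
    have htri := abs_sub_abs_le_abs_sub ((j : ℝ) * N) (n ⟨0, hd⟩ : ℝ)
    rw [abs_sub_comm] at htri
    linarith [abs_le_jap n ⟨0, hd⟩]
  have hsin : |Real.sin (t * jap n) / jap n| * N ≤ 2 := by
    rw [abs_div, abs_of_pos (jap_pos n), div_mul_eq_mul_div, div_le_iff₀ (jap_pos n)]
    nlinarith [Real.abs_sin_le_one (t * jap n)]
  have hcos := Real.abs_cos_le_one (t * jap n)
  refine (norm_add_le _ _).trans ?_
  simp only [norm_mul, Complex.norm_real, Complex.norm_intCast, Real.norm_eq_abs,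
    abs_of_pos hNpos, ← mul_assoc]
  nlinarith [norm_nonneg (phi0 R A N n)]

theorem zfree_support {d : ℕ} {R A : ℝ} {N : ℤ} {t : ℝ} {n : Fin d → ℤ} (hA : 0 ≤ A)
    (h : zfree R A N t n ≠ 0) : n ∈ shiftedCubes d 2 N ⌊3 * A / 2⌋₊ := by
  obtain ⟨j, -, hj, hQ⟩ := exists_of_phi0_ne_zero (phi0_ne_zero_of_zfree_ne_zero h)
  refine mem_shiftedCubes j hj fun i => ?_
  rw [← Int.natCast_natAbs, Nat.cast_le, Nat.le_floor_iff (by linarith), Nat.cast_natAbs,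
    Int.cast_abs]
  linarith [hQ i]

theorem dcube_zfree_support {d : ℕ} {R A : ℝ} {N : ℤ} {t : ℝ} {n : Fin d → ℤ} (hA : 0 ≤ A)
    (h : dcube (zfree R A N t) n ≠ 0) : n ∈ shiftedCubes d 6 N ⌊3 * A / 2⌋₊ := by
  obtain ⟨m, k, rfl, hm, hk⟩ := exists_of_dconv_ne_zero h
  obtain ⟨p, q, rfl, hp, hq⟩ := exists_of_dconv_ne_zero hm
  obtain ⟨j₁, -, hj₁, hQ₁⟩ := exists_of_phi0_ne_zero (phi0_ne_zero_of_zfree_ne_zero hp)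
  obtain ⟨j₂, -, hj₂, hQ₂⟩ := exists_of_phi0_ne_zero (phi0_ne_zero_of_zfree_ne_zero hq)
  obtain ⟨j₃, -, hj₃, hQ₃⟩ := exists_of_phi0_ne_zero (phi0_ne_zero_of_zfree_ne_zero hk)
  refine mem_shiftedCubes (j₁ + j₂ + j₃) ?_ fun i => ?_
  · rw [abs_le] at *
    push_cast
    constructor <;> linarith [hj₁.1, hj₁.2, hj₂.1, hj₂.2, hj₃.1, hj₃.2]
  · rw [← Int.natCast_natAbs, Nat.cast_le, Nat.le_floor_iff (by linarith), Nat.cast_natAbs,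
      Int.cast_abs]
    have hsum : (p + q + k) i - (j₁ + j₂ + j₃) * N * e1 d i =
        (p i - j₁ * N * e1 d i) + (q i - j₂ * N * e1 d i) + (k i - j₃ * N * e1 d i) := by
      simp only [Pi.add_apply]
      ring
    rw [hsum, Int.cast_add, Int.cast_add]
    refine (abs_add_three _ _ _).trans ?_
    linarith [hQ₁ i, hQ₂ i, hQ₃ i]

theorem norm_dcube_zfree_le {d : ℕ} (hd : 1 ≤ d) {R A : ℝ} (hR : 0 ≤ R) (hA : 1 ≤ A) {N : ℤ}
    (hN : 8 * A ≤ N) (t : ℝ) (n : Fin d → ℤ) :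
    ‖dcube (zfree R A N t) n‖ ≤ 27 * (5 * 4 ^ d) ^ 2 * R ^ 3 * (A ^ d) ^ 2 := by
  set F := shiftedCubes d 2 N ⌊3 * A / 2⌋₊
  have hz := norm_zfree_le hd hR hA hN t
  have hF : ∀ m, zfree R A N t m ≠ 0 → m ∈ F := fun m => zfree_support (by linarith)
  have hcard : (F.card : ℝ) ≤ 5 * 4 ^ d * A ^ d := by
    calc (F.card : ℝ) ≤ 5 * (2 * (⌊3 * A / 2⌋₊ : ℝ) + 1) ^ d := by
          exact_mod_cast card_shiftedCubes_le d 2 N ⌊3 * A / 2⌋₊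
      _ ≤ 5 * (4 * A) ^ d := by
          gcongr
          linarith [Nat.floor_le (a := 3 * A / 2) (by linarith)]
      _ = _ := by ring
  refine (norm_dconv_le (norm_dconv_le hz hz hF) hz hF n).trans ?_
  calc (F.card : ℝ) * (F.card * (3 * R * (3 * R)) * (3 * R))
      = 27 * R ^ 3 * (F.card : ℝ) ^ 2 := by ring
    _ ≤ 27 * R ^ 3 * (5 * 4 ^ d * A ^ d) ^ 2 := by gcongr
    _ = _ := by ring

theorem norm_Xi1_le {d : ℕ} (hd : 1 ≤ d) {R A : ℝ} (hR : 0 ≤ R) (hA : 1 ≤ A) {N : ℤ}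
    (hN : 8 * A ≤ N) {t : ℝ} (ht : 0 ≤ t) (n : Fin d → ℤ) :
    ‖Xi1 R A N t n‖ ≤ 27 * (5 * 4 ^ d) ^ 2 * t ^ 2 * R ^ 3 * (A ^ d) ^ 2 := by
  rw [Xi1, norm_neg]
  refine (intervalIntegral.norm_integral_le_of_norm_le_const
    (C := t * (27 * (5 * 4 ^ d) ^ 2 * R ^ 3 * (A ^ d) ^ 2)) fun r hr => ?_).trans_eq ?_
  · rw [Set.uIoc_of_le ht] at hr
    rw [norm_mul, Complex.norm_real, Real.norm_eq_abs]
    refine mul_le_mul ?_ (norm_dcube_zfree_le hd hR hA hN r n) (norm_nonneg _) ht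
    rw [abs_div, abs_of_pos (jap_pos n), div_le_iff₀ (jap_pos n)]
    refine Real.abs_sin_le_abs.trans ?_
    rw [abs_mul, abs_of_pos (jap_pos n), abs_of_nonneg (by linarith [hr.2])]
    exact mul_le_mul_of_nonneg_right (by linarith [hr.1]) (jap_pos n).le
  · rw [sub_zero, abs_of_nonneg ht]
    ring

theorem Xi1_support {d : ℕ} {R A : ℝ} {N : ℤ} {t : ℝ} {n : Fin d → ℤ} (hA : 0 ≤ A)
    (h : Xi1 R A N t n ≠ 0) : n ∈ shiftedCubes d 6 N ⌊3 * A / 2⌋₊ := by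
  by_contra hn
  have hzero : ∀ r, dcube (zfree R A N r) n = 0 := fun r => by
    by_contra hr
    exact hn (dcube_zfree_support hA hr)
  exact h (by simp [Xi1, hzero])

theorem hsum_le_of_support {d : ℕ} (σ : ℝ) {v : (Fin d → ℤ) → ℂ} {K : ℝ}
    {F : Finset (Fin d → ℤ)} (hv : ∀ n, ‖v n‖ ≤ K) (hF : ∀ n, v n ≠ 0 → n ∈ F) :
    hsum σ v ≤ K ^ 2 * ∑ n ∈ F, jap n ^ (2 * σ) := by
  rw [hsum, tsum_eq_sum (s := F), Finset.mul_sum]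
  · refine Finset.sum_le_sum fun n _ => ?_
    rw [mul_comm]
    exact mul_le_mul_of_nonneg_right (pow_le_pow_left₀ (norm_nonneg _) (hv n) 2)
      (Real.rpow_nonneg (jap_pos n).le _)
  · intro n hn
    have : v n = 0 := by
      by_contra h
      exact hn (hF n h)
    simp [this]

/-- Upper bound `‖Ξ₁(t)‖_{H^s} ≲ t² R³ A^{2d} A^{d/2+s}` for `-d/2 < s < 0`,
valid for `R, A ≥ 1`, `N ≥ 8A` and all `t ≥ 0`. -/
theorem Xi1_upper_bound (d : ℕ) (hd : 1 ≤ d) (s : ℝ)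
    (hs1 : -(d : ℝ) / 2 < s) (hs2 : s < 0) :
    ∃ C > (0 : ℝ), ∀ R A : ℝ, 1 ≤ R → 1 ≤ A →
      ∀ N : ℤ, 8 * A ≤ (N : ℝ) →
      ∀ t : ℝ, 0 ≤ t →
        Real.sqrt (hsum s (Xi1 (d := d) R A N t))
          ≤ C * t ^ 2 * R ^ 3 * A ^ (2 * (d : ℝ)) * A ^ ((d : ℝ) / 2 + s) := by
  have hd0 : (0 : ℝ) < d := by exact_mod_cast hd
  have ha : 0 < 1 + 2 * s / d := by
    have : -1 < 2 * s / d := by rw [lt_div_iff₀ hd0]; linarith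
    linarith
  set D : ℝ := 13 * ((1 + 2 * (2 ^ (1 + 2 * s / d) / (1 + 2 * s / d))) ^ d + 4 ^ d) with hD
  have hDpos : 0 < D := by positivity
  refine ⟨27 * (5 * 4 ^ d) ^ 2 * Real.sqrt D, by positivity, ?_⟩
  intro R A hR hA N hN t ht
  have hA0 : 0 < A := by linarith
  have hsum_le := hsum_le_of_support s (norm_Xi1_le (R := R) hd (by linarith) hA hN ht)
    fun n => Xi1_support hA0.le
  have hweights := sum_shiftedCubes_jap_rpow_le hd hs1 hs2 hA hN
    (Nat.floor_le (a := 3 * A / 2) (by linarith)) 6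
  have hconst : (2 * ((6 : ℕ) : ℝ) + 1) *
      ((1 + 2 * (2 ^ (1 + 2 * s / d) / (1 + 2 * s / d))) ^ d + 4 ^ d) = D := by
    rw [hD]
    norm_num
  rw [hconst] at hweights
  refine Real.sqrt_le_iff.2 ⟨by positivity, hsum_le.trans ?_⟩
  have hA2 : A ^ (2 * (d : ℝ)) = (A ^ d) ^ 2 := by
    rw [mul_comm, Real.rpow_mul hA0.le, Real.rpow_natCast, Real.rpow_two]
  have hAs : A ^ ((d : ℝ) + 2 * s) = (A ^ ((d : ℝ) / 2 + s)) ^ 2 := by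
    rw [← Real.rpow_mul_natCast hA0.le]
    congr 1
    push_cast
    ring
  rw [hAs] at hweights
  rw [hA2]
  refine (mul_le_mul_of_nonneg_left hweights (sq_nonneg _)).trans_eq ?_
  simp only [mul_pow, Real.sq_sqrt hDpos.le]
  ring
end

section
/- Let ρ ∈ [−1, 1] and k, m ∈ ℕ. Then ∫_ℝ ∫_ℝ H_k(x) · H_m(ρ·x + √(1−ρ²)·y) dγ(x) dγ(y) = k! · ρ^k if k = m, and 0 otherwise. (This expresses that for mean-zero jointly Gaussian random variables g₁, g₂ of unit variance and correlation ρ = E[g₁g₂], one has E[H_k(g₁) H_m(g₂)] = δ_{km} k! ρ^k; here the pair (g₁, g₂) is realized as (x, ρx + √(1−ρ²) y) under the product of two standard Gaussians.) -/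
open MeasureTheory ProbabilityTheory

open Polynomial in
/-- The Appell property of the Hermite polynomials. -/
lemma derivative_hermite_succ (n : ℕ) :
    derivative (hermite (n + 1)) = ((n : ℤ[X]) + 1) * hermite n := by
  induction n with
  | zero => simp
  | succ n ih =>
    rw [hermite_succ (n + 1), derivative_sub, derivative_mul, derivative_X, ih, derivative_mul,
      hermite_succ n]
    simp only [derivative_add, derivative_natCast, derivative_one]
    push_cast
    ring

lemma integrable_eval_gaussianReal (p : Polynomial ℝ) :
    Integrable (fun x ↦ p.eval x) (gaussianReal 0 1) := by
  simp only [Polynomial.eval_eq_sum_range]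
  refine integrable_finsetSum _ fun i _ ↦ Integrable.const_mul ?_ _
  refine integrable_pow_of_mem_interior_integrableExpSet (X := fun x : ℝ ↦ x) ?_ i
  simp [integrableExpSet_fun_id_gaussianReal]

lemma integrable_gaussianPDFReal_mul_eval (p : Polynomial ℝ) :
    Integrable (fun x ↦ gaussianPDFReal 0 1 x * p.eval x) := by
  have h := integrable_eval_gaussianReal p
  rw [gaussianReal_of_var_ne_zero _ one_ne_zero,
    integrable_withDensity_iff_integrable_smul' (measurable_gaussianPDF 0 1)
      (Filter.Eventually.of_forall fun _ ↦ gaussianPDF_lt_top)] at h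
  simpa [toReal_gaussianPDF] using h

lemma hasDerivAt_gaussianPDFReal (x : ℝ) :
    HasDerivAt (gaussianPDFReal 0 1) (-x * gaussianPDFReal 0 1 x) x := by
  have h : HasDerivAt (fun x : ℝ ↦ -(x - 0) ^ 2 / (2 * ((1 : NNReal) : ℝ))) (-x) x :=
    (((hasDerivAt_id' x).sub_const 0).pow 2).neg.div_const _ |>.congr_deriv (by simp; ring)
  rw [gaussianPDFReal_def]
  exact (h.exp.const_mul _).congr_deriv (by ring)

/-- Gaussian integration by parts for polynomials. -/
lemma integral_mul_eval_gaussianReal (p : Polynomial ℝ) :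
    ∫ x, x * p.eval x ∂(gaussianReal 0 1) = ∫ x, p.derivative.eval x ∂(gaussianReal 0 1) := by
  have key : ∫ x, gaussianPDFReal 0 1 x * (p.derivative - Polynomial.X * p).eval x = 0 := by
    refine integral_eq_zero_of_hasDerivAt_of_integrable
      (f := fun x ↦ gaussianPDFReal 0 1 x * p.eval x) (fun x ↦ ?_)
      (integrable_gaussianPDFReal_mul_eval _) (integrable_gaussianPDFReal_mul_eval _)
    refine ((hasDerivAt_gaussianPDFReal x).mul (p.hasDerivAt x)).congr_deriv ?_
    simp only [Polynomial.eval_sub, Polynomial.eval_mul, Polynomial.eval_X]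
    ring
  have h := integral_gaussianReal_eq_integral_smul (μ := 0) (v := 1) one_ne_zero
    (f := fun x ↦ (p.derivative - Polynomial.X * p).eval x)
  simp only [smul_eq_mul] at h
  rw [key] at h
  have hX := integrable_eval_gaussianReal (Polynomial.X * p)
  simp only [Polynomial.eval_sub] at h
  rw [integral_sub (integrable_eval_gaussianReal _) hX] at h
  simp only [Polynomial.eval_mul, Polynomial.eval_X] at h
  linarith

/-- Multiplication by a Hermite polynomial raises its index under integration by parts. -/
lemma integral_hermite_succ_mul_eval (k : ℕ) (q : Polynomial ℝ) :
    ∫ x, Polynomial.aeval x (Polynomial.hermite (k + 1)) * q.eval x ∂(gaussianReal 0 1) =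
      ∫ x, Polynomial.aeval x (Polynomial.hermite k) * q.derivative.eval x
        ∂(gaussianReal 0 1) := by
  set H := (Polynomial.hermite k).map (Int.castRingHom ℝ) with hH
  have hk (x : ℝ) : Polynomial.aeval x (Polynomial.hermite k) = H.eval x := by
    rw [hH, Polynomial.eval_map, Polynomial.aeval_def]; rfl
  have hk' (x : ℝ) : Polynomial.aeval x (Polynomial.hermite k).derivative =
      H.derivative.eval x := by
    rw [hH, Polynomial.derivative_map, Polynomial.eval_map, Polynomial.aeval_def]; rfl
  have h := integral_mul_eval_gaussianReal (H * q)
  have h1 := integrable_eval_gaussianReal (Polynomial.X * (H * q))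
  have h2 := integrable_eval_gaussianReal (H.derivative * q)
  have h3 := integrable_eval_gaussianReal (H * q.derivative)
  simp only [Polynomial.derivative_mul, Polynomial.eval_add, Polynomial.eval_mul,
    Polynomial.eval_X] at h h1 h2 h3
  rw [integral_add h2 h3] at h
  simp only [Polynomial.hermite_succ, map_sub, map_mul, Polynomial.aeval_X, hk, hk']
  rw [← sub_eq_iff_eq_add', ← integral_sub h1 h2] at h
  rw [← h]
  exact integral_congr_ae (Filter.Eventually.of_forall fun x ↦ by ring)

lemma integral_hermite_gaussianReal (m : ℕ) :
    ∫ x : ℝ, Polynomial.aeval x (Polynomial.hermite m) ∂(gaussianReal 0 1) =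
      if m = 0 then 1 else 0 := by
  cases m with
  | zero => simp
  | succ m => simpa using integral_hermite_succ_mul_eval m 1

/-- A unit combination of independent standard Gaussians is standard Gaussian. -/
lemma integral_integral_eval_gaussianReal {a b : ℝ} (hab : a ^ 2 + b ^ 2 = 1)
    (p : Polynomial ℝ) :
    ∫ y, ∫ x, p.eval (a * x + b * y) ∂(gaussianReal 0 1) ∂(gaussianReal 0 1) =
      ∫ x, p.eval x ∂(gaussianReal 0 1) := by
  have hconv : ((gaussianReal 0 1).map (b * ·)) ∗ ((gaussianReal 0 1).map (a * ·)) =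
      gaussianReal 0 1 := by
    rw [gaussianReal_map_const_mul, gaussianReal_map_const_mul, gaussianReal_conv_gaussianReal]
    congr 1
    · simp
    · ext
      simp
      linarith
  have hp := integrable_eval_gaussianReal p
  rw [← hconv] at hp
  conv_rhs => rw [← hconv, integral_conv hp]
  have hm (c : ℝ) : Measurable (c * · : ℝ → ℝ) := measurable_const_mul c
  have hc (y : ℝ) : ∫ x, p.eval (y + x) ∂((gaussianReal 0 1).map (a * ·)) =
      ∫ x, p.eval (y + a * x) ∂(gaussianReal 0 1) :=
    integral_map (hm a).aemeasurable
      (p.continuous.comp (continuous_const.add continuous_id)).aestronglyMeasurable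
  simp only [hc]
  rw [integral_map (hm b).aemeasurable]
  · simp only [add_comm]
  · refine StronglyMeasurable.aestronglyMeasurable ?_
    refine StronglyMeasurable.integral_prod_right
      (f := fun y x ↦ p.eval (y + a * x)) (Continuous.stronglyMeasurable ?_)
    exact p.continuous.comp (by fun_prop)

/-- Covariance of Hermite polynomials of correlated Gaussians:
for `ρ ∈ [-1,1]`, `E[H_k(g₁) H_m(g₂)] = δ_{km} k! ρ^k`, where the pair
`(g₁, g₂)` of standard jointly Gaussian variables with correlation `ρ` is
realized as `(x, ρx + √(1-ρ²) y)` under `γ ⊗ γ`. -/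
theorem hermite_correlated_gaussians (ρ : ℝ) (hρ : ρ ∈ Set.Icc (-1 : ℝ) 1) (k m : ℕ) :
    ∫ y : ℝ, ∫ x : ℝ,
        (Polynomial.aeval x (Polynomial.hermite k) : ℝ) *
          (Polynomial.aeval (ρ * x + Real.sqrt (1 - ρ ^ 2) * y)
            (Polynomial.hermite m))
        ∂(gaussianReal 0 1) ∂(gaussianReal 0 1) =
      if k = m then (Nat.factorial k : ℝ) * ρ ^ k else 0 := by
  have haeval (p : Polynomial ℤ) (z : ℝ) :
      Polynomial.aeval z p = (p.map (Int.castRingHom ℝ)).eval z := by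
    rw [Polynomial.eval_map, Polynomial.aeval_def]; rfl
  induction k generalizing m with
  | zero =>
    have hab : ρ ^ 2 + Real.sqrt (1 - ρ ^ 2) ^ 2 = 1 := by
      rw [Real.sq_sqrt (by nlinarith [hρ.1, hρ.2])]
      ring
    have h := integral_integral_eval_gaussianReal hab
      ((Polynomial.hermite m).map (Int.castRingHom ℝ))
    simp only [← haeval, integral_hermite_gaussianReal] at h
    simpa [eq_comm] using h
  | succ k ih =>
    have hstep (y : ℝ) := integral_hermite_succ_mul_eval k
      (((Polynomial.hermite m).map (Int.castRingHom ℝ)).comp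
        (Polynomial.C ρ * Polynomial.X + Polynomial.C (Real.sqrt (1 - ρ ^ 2) * y)))
    simp only [Polynomial.derivative_comp, Polynomial.eval_comp, Polynomial.eval_add,
      Polynomial.eval_mul, Polynomial.eval_C, Polynomial.eval_X, Polynomial.derivative_map,
      ← haeval, Polynomial.derivative_add, Polynomial.derivative_mul, Polynomial.derivative_C,
      Polynomial.derivative_X, zero_mul, mul_one, zero_add, add_zero] at hstep
    simp only [hstep]
    cases m with
    | zero => simp
    | succ m =>
      have hreorder (x y : ℝ) : Polynomial.aeval x (Polynomial.hermite k) *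
          (ρ * Polynomial.aeval (ρ * x + Real.sqrt (1 - ρ ^ 2) * y)
            (Polynomial.hermite (m + 1)).derivative) = (ρ * (m + 1)) *
          (Polynomial.aeval x (Polynomial.hermite k) *
            Polynomial.aeval (ρ * x + Real.sqrt (1 - ρ ^ 2) * y) (Polynomial.hermite m)) := by
        rw [derivative_hermite_succ]
        simp only [map_mul, map_add, map_natCast, map_one]
        ring
      simp only [hreorder, integral_const_mul, ih, Nat.add_right_cancel_iff]
      split_ifs with h
      · subst h
        rw [Nat.factorial_succ]
        push_cast
        ring
      · simp
end

section
/- For every integer ℓ ≥ 1, every ε ∈ (0, 1], and every γ ∈ (0, 1], there exists a constant C > 0 such that for every n ∈ ℤ² and every real N ≥ 1, Σ_{(n₁,…,n_ℓ) ∈ (ℤ²)^ℓ : n₁+⋯+n_ℓ = n, max_j |n_j| > N} Π_{j=1}^{ℓ} (1 + |n_j|²)^{−1} ≤ C · N^{−γ} · (1 + |n|²)^{(−2+ε+γ)/2}. -/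
open scoped BigOperators Classical

/-- The squared Japanese bracket `⟨n⟩² = 1 + |n|²` of a lattice point. -/
noncomputable def sqBracket (n : ℤ × ℤ) : ℝ := 1 + (n.1 : ℝ) ^ 2 + (n.2 : ℝ) ^ 2

lemma one_le_sqBracket (n : ℤ × ℤ) : 1 ≤ sqBracket n := by
  unfold sqBracket
  nlinarith [sq_nonneg (n.1 : ℝ), sq_nonneg (n.2 : ℝ)]

lemma sqBracket_pos (n : ℤ × ℤ) : 0 < sqBracket n :=
  zero_lt_one.trans_le (one_le_sqBracket n)

lemma summable_one_add_int_sq_rpow {p : ℝ} (hp : 1 / 2 < p) :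
    Summable fun a : ℤ => (1 + (a : ℝ) ^ 2) ^ (-p) := by
  have h1 : Summable fun a : ℤ => |(a : ℝ)| ^ (-(2 * p)) :=
    Real.summable_abs_int_rpow (by linarith)
  have h2 : Summable fun a : ℤ => if a = 0 then (1 : ℝ) else 0 :=
    (hasSum_ite_eq 0 1).summable
  refine Summable.of_nonneg_of_le (fun a => by positivity) (fun a => ?_) (h1.add h2)
  by_cases ha : a = 0
  · subst ha
    simp only [Int.cast_zero, if_true]
    norm_num
    positivity
  · have ha' : 0 < |(a : ℝ)| := abs_pos.2 (Int.cast_ne_zero.2 ha)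
    simp only [ha, if_false, add_zero]
    rw [neg_mul_eq_mul_neg, Real.rpow_mul ha'.le, Real.rpow_two, sq_abs]
    have : 0 < (a : ℝ) ^ 2 := by rw [← sq_abs]; positivity
    exact Real.rpow_le_rpow_of_nonpos this (by linarith) (by linarith)

lemma summable_sqBracket_rpow {p : ℝ} (hp : 1 < p) :
    Summable fun n : ℤ × ℤ => sqBracket n ^ (-p) := by
  have h := summable_one_add_int_sq_rpow (p := p / 2) (by linarith)
  have hprod := h.mul_of_nonneg h (fun a => by positivity) (fun a => by positivity)
  refine Summable.of_nonneg_of_le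
    (fun n => Real.rpow_nonneg (sqBracket_pos n).le _) (fun n => ?_) hprod
  have hle : (1 + (n.1 : ℝ) ^ 2) * (1 + (n.2 : ℝ) ^ 2) ≤ sqBracket n ^ (2 : ℝ) := by
    rw [Real.rpow_two]
    unfold sqBracket
    nlinarith [sq_nonneg (n.1 : ℝ), sq_nonneg (n.2 : ℝ),
      mul_nonneg (sq_nonneg (n.1 : ℝ)) (sq_nonneg (n.2 : ℝ)),
      sq_nonneg ((n.1 : ℝ) ^ 2), sq_nonneg ((n.2 : ℝ) ^ 2)]
  have heq : sqBracket n ^ (-p) = (sqBracket n ^ (2 : ℝ)) ^ (-(p / 2)) := by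
    rw [← Real.rpow_mul (sqBracket_pos n).le]
    ring_nf
  rw [heq, ← Real.mul_rpow (by positivity) (by positivity)]
  exact Real.rpow_le_rpow_of_nonpos (by positivity) hle (by linarith)

lemma summable_fin_prod_of_nonneg {α : Type*} {f : α → ℝ} (hf0 : ∀ a, 0 ≤ f a)
    (hf : Summable f) (L : ℕ) : Summable fun v : Fin L → α => ∏ j, f (v j) := by
  induction L with
  | zero => exact Summable.of_finite
  | succ L ih =>
    rw [← (Fin.consEquiv fun _ => α).summable_iff]
    refine (hf.mul_of_nonneg ih hf0 fun v => Finset.prod_nonneg fun j _ => hf0 _).congr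
      fun v => ?_
    simp [Fin.consEquiv, Fin.prod_univ_succ]

/-- On the tuples with prescribed sum, a function of all the entries but the `k`-th has the same
sum as over unconstrained tuples. -/
lemma hasSum_ite_sum_eq_removeNth {G : Type*} [AddCommGroup G] [DecidableEq G] {L : ℕ} (k : Fin (L + 1))
    (n : G) {g : (Fin L → G) → ℝ} {a : ℝ} (hg : HasSum g a) :
    HasSum (fun m : Fin (L + 1) → G => if ∑ j, m j = n then g (k.removeNth m) else 0) a := by
  let e : (Fin L → G) → (Fin (L + 1) → G) := fun v => k.insertNth (n - ∑ j, v j) v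
  have he : Function.Injective e := fun v v' h => by
    have := congrArg k.removeNth h
    simpa [e] using this
  rw [← he.hasSum_iff]
  · convert hg using 1
    ext v
    simp [e, Fin.sum_univ_succAbove _ k]
  · intro m hm
    rw [if_neg]
    intro hs
    refine hm ⟨k.removeNth m, ?_⟩
    have : n - ∑ j, k.removeNth m j = m k := by
      rw [← hs, Fin.sum_univ_succAbove _ k]
      simp [Fin.removeNth]
    simp [e, this]

lemma sqBracket_sum_le {ι : Type*} [Fintype ι] (m : ι → ℤ × ℤ) (k : ι)
    (hk : ∀ i, sqBracket (m i) ≤ sqBracket (m k)) :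
    sqBracket (∑ i, m i) ≤ (Fintype.card ι : ℝ) ^ 2 * sqBracket (m k) := by
  have h1 := sq_sum_le_card_mul_sum_sq (s := Finset.univ) (f := fun i => ((m i).1 : ℝ))
  have h2 := sq_sum_le_card_mul_sum_sq (s := Finset.univ) (f := fun i => ((m i).2 : ℝ))
  have h3 : ∑ i, sqBracket (m i) ≤ Fintype.card ι * sqBracket (m k) := by
    simpa using Finset.sum_le_card_nsmul Finset.univ _ _ fun i _ => hk i
  have hc : (1 : ℝ) ≤ Fintype.card ι := by
    exact_mod_cast Fintype.card_pos_iff.2 ⟨k⟩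
  have h4 : ∑ i, sqBracket (m i) =
      Fintype.card ι + ∑ i, ((m i).1 : ℝ) ^ 2 + ∑ i, ((m i).2 : ℝ) ^ 2 := by
    simp [sqBracket, Finset.sum_add_distrib]
  rw [h4] at h3
  have h5 := mul_le_mul_of_nonneg_left h3 (zero_le_one.trans hc)
  rw [Finset.card_univ] at h1 h2
  have h6 : sqBracket (∑ i, m i) =
      1 + (∑ i, ((m i).1 : ℝ)) ^ 2 + (∑ i, ((m i).2 : ℝ)) ^ 2 := by
    simp [sqBracket, Prod.fst_sum, Prod.snd_sum]
  rw [h6]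
  nlinarith

/-- A product of inverses is controlled by omitting its largest factor and spending the decay of
that factor on `N`, on `W` and on the remaining factors. -/
lemma prod_inv_le_of_le_max {L : ℕ} {w : Fin (L + 1) → ℝ} {k : Fin (L + 1)}
    (hw1 : ∀ i, 1 ≤ w i) (hwk : ∀ i, w i ≤ w k) {N W A γ θ δ : ℝ} (hN : 1 ≤ N)
    (hNk : N ^ 2 ≤ w k) (hW : 0 < W) (hA : 0 < A) (hWk : W ≤ A * w k) (hγ : 0 ≤ γ) (hθ : 0 ≤ θ)
    (hδ : 0 ≤ δ) (hsum : γ / 2 + θ + L * δ ≤ 1) :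
    ∏ i, (w i)⁻¹ ≤ N ^ (-γ) * (A ^ θ * W ^ (-θ)) * ∏ j, w (k.succAbove j) ^ (-(1 + δ)) := by
  have hpos : ∀ i, 0 < w i := fun i => zero_lt_one.trans_le (hw1 i)
  have hk := hpos k
  have hN0 : 0 < N := by linarith
  have h1 : w k ^ (-(γ / 2)) ≤ N ^ (-γ) := by
    have : N ^ (-γ) = (N ^ 2) ^ (-(γ / 2)) := by
      rw [← Real.rpow_two, ← Real.rpow_mul hN0.le]
      ring_nf
    rw [this]
    exact Real.rpow_le_rpow_of_nonpos (by positivity) hNk (by linarith)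
  have h2 : w k ^ (-θ) ≤ A ^ θ * W ^ (-θ) := by
    have h := Real.rpow_le_rpow_of_nonpos hW hWk (neg_nonpos.2 hθ)
    rw [Real.mul_rpow hA.le hk.le] at h
    calc w k ^ (-θ) = A ^ θ * (A ^ (-θ) * w k ^ (-θ)) := by
          rw [← mul_assoc, ← Real.rpow_add hA]; simp
      _ ≤ _ := by gcongr
  have h3 : w k ^ (-(L * δ)) ≤ ∏ j, w (k.succAbove j) ^ (-δ) := by
    have : w k ^ (-(L * δ)) = ∏ _j : Fin L, w k ^ (-δ) := by
      rw [Finset.prod_const, Finset.card_univ, Fintype.card_fin, ← Real.rpow_natCast,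
        ← Real.rpow_mul hk.le]
      ring_nf
    rw [this]
    exact Finset.prod_le_prod (fun j _ => by positivity) fun j _ =>
      Real.rpow_le_rpow_of_nonpos (hpos _) (hwk _) (by linarith)
  have h4 : (w k)⁻¹ ≤ w k ^ (-(γ / 2)) * w k ^ (-θ) * w k ^ (-(L * δ)) := by
    rw [← Real.rpow_neg_one, ← Real.rpow_add hk, ← Real.rpow_add hk]
    exact Real.rpow_le_rpow_of_exponent_le (hw1 k) (by linarith)
  have h5 : ∏ j, w (k.succAbove j) ^ (-(1 + δ)) =
      (∏ j, w (k.succAbove j) ^ (-δ)) * ∏ j, (w (k.succAbove j))⁻¹ := by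
    rw [← Finset.prod_mul_distrib]
    refine Finset.prod_congr rfl fun j _ => ?_
    rw [← Real.rpow_neg_one, ← Real.rpow_add (hpos _)]
    ring_nf
  have h6 : 0 ≤ ∏ j, (w (k.succAbove j))⁻¹ :=
    Finset.prod_nonneg fun j _ => inv_nonneg.2 (hpos _).le
  rw [Fin.prod_univ_succAbove _ k, h5, ← mul_assoc]
  refine mul_le_mul_of_nonneg_right (h4.trans ?_) h6
  gcongr

/-- Tail convolution estimate on `ℤ²`: for `ℓ ≥ 1`, `0 < ε ≤ 1` and `0 < γ ≤ 1`,
`Σ_{n₁+⋯+n_ℓ = n, max_j |n_j| > N} Π_j ⟨n_j⟩^{-2} ≲ N^{-γ} ⟨n⟩^{-2+ε+γ}`. -/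
theorem lattice_convolution_tail_estimate (ℓ : ℕ) (hℓ : 1 ≤ ℓ) (ε γ : ℝ)
    (hε1 : 0 < ε) (hε2 : ε ≤ 1) (hγ1 : 0 < γ) (hγ2 : γ ≤ 1) :
    ∃ C > (0 : ℝ), ∀ n : ℤ × ℤ, ∀ N : ℝ, 1 ≤ N →
      Summable (fun m : Fin ℓ → ℤ × ℤ =>
        if (∑ j, m j) = n ∧
            (∃ j, N < Real.sqrt (((m j).1 : ℝ) ^ 2 + ((m j).2 : ℝ) ^ 2)) then
          ∏ j, (1 + ((m j).1 : ℝ) ^ 2 + ((m j).2 : ℝ) ^ 2)⁻¹ else 0) ∧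
      (∑' m : Fin ℓ → ℤ × ℤ,
        if (∑ j, m j) = n ∧
            (∃ j, N < Real.sqrt (((m j).1 : ℝ) ^ 2 + ((m j).2 : ℝ) ^ 2)) then
          ∏ j, (1 + ((m j).1 : ℝ) ^ 2 + ((m j).2 : ℝ) ^ 2)⁻¹ else 0) ≤
        C * N ^ (-γ) * (1 + (n.1 : ℝ) ^ 2 + (n.2 : ℝ) ^ 2) ^ ((-2 + ε + γ) / 2) := by
  obtain ⟨L, rfl⟩ : ∃ L, ℓ = L + 1 := ⟨ℓ - 1, by omega⟩
  set δ : ℝ := ε / (2 * (L + 1)) with hδ_def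
  set θ : ℝ := (2 - ε - γ) / 2 with hθ_def
  have hδ : 0 < δ := by positivity
  have hLδ : L * δ ≤ ε / 2 := by
    rw [hδ_def, mul_div_assoc', div_le_div_iff₀ (by positivity) (by norm_num)]
    nlinarith
  set g : (Fin L → ℤ × ℤ) → ℝ := fun v => ∏ j, sqBracket (v j) ^ (-(1 + δ)) with hg_def
  have hg0 : ∀ v, 0 ≤ g v := fun v =>
    Finset.prod_nonneg fun j _ => Real.rpow_nonneg (sqBracket_pos _).le _
  have hg : Summable g := summable_fin_prod_of_nonneg
    (fun n => Real.rpow_nonneg (sqBracket_pos n).le _)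
    (summable_sqBracket_rpow (by linarith)) L
  set T : ℝ := ∑' v, g v with hT_def
  have hT : 0 ≤ T := tsum_nonneg hg0
  set A : ℝ := ((L : ℝ) + 1) ^ 2 with hA_def
  have hA : 0 < A := by positivity
  refine ⟨A ^ θ * ((L + 1) * T + 1), by positivity, fun n N hN => ?_⟩
  set D : ℝ := N ^ (-γ) * (A ^ θ * sqBracket n ^ (-θ)) with hD_def
  have hW := sqBracket_pos n
  have hD : 0 ≤ D := by positivity
  have hmaj : HasSum (fun m : Fin (L + 1) → ℤ × ℤ =>
      D * ∑ k : Fin (L + 1), if ∑ j, m j = n then g (k.removeNth m) else 0) (D * ∑ _k : Fin (L + 1), T) :=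
    (hasSum_sum fun k _ => hasSum_ite_sum_eq_removeNth k n hg.hasSum).mul_left D
  have hmaj0 : ∀ (m : Fin (L + 1) → ℤ × ℤ) (k : Fin (L + 1)),
      0 ≤ if ∑ j, m j = n then g (k.removeNth m) else 0 := fun m k => by
    split_ifs
    exacts [hg0 _, le_rfl]
  have hle : ∀ m : Fin (L + 1) → ℤ × ℤ,
      (if (∑ j, m j) = n ∧
          (∃ j, N < Real.sqrt (((m j).1 : ℝ) ^ 2 + ((m j).2 : ℝ) ^ 2)) then
        ∏ j, (1 + ((m j).1 : ℝ) ^ 2 + ((m j).2 : ℝ) ^ 2)⁻¹ else 0) ≤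
      D * ∑ k : Fin (L + 1), if ∑ j, m j = n then g (k.removeNth m) else 0 := fun m => by
    by_cases h : (∑ j, m j) = n ∧
        (∃ j, N < Real.sqrt (((m j).1 : ℝ) ^ 2 + ((m j).2 : ℝ) ^ 2))
    · rw [if_pos h]
      obtain ⟨hs, j, hj⟩ := h
      simp only [hs, if_true]
      obtain ⟨k, -, hk⟩ := Finset.exists_max_image Finset.univ
        (fun i => sqBracket (m i)) Finset.univ_nonempty
      have hNk : N ^ 2 ≤ sqBracket (m k) := by
        refine le_trans ?_ (hk j (Finset.mem_univ j))
        have := (Real.lt_sqrt (by linarith)).1 hj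
        unfold sqBracket
        linarith
      have hWk : sqBracket n ≤ A * sqBracket (m k) := by
        have := sqBracket_sum_le m k fun i => hk i (Finset.mem_univ i)
        rw [hs] at this
        simpa [hA_def] using this
      have := prod_inv_le_of_le_max (w := fun i => sqBracket (m i)) (θ := θ) (δ := δ)
        (fun i => one_le_sqBracket _) (fun i => hk i (Finset.mem_univ i)) hN hNk hW hA hWk hγ1.le
        (by rw [hθ_def]; linarith) hδ.le (by rw [hθ_def]; linarith)
      refine this.trans (mul_le_mul_of_nonneg_left ?_ hD)
      exact Finset.single_le_sum (f := fun k : Fin (L + 1) => g (k.removeNth m))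
        (fun i _ => hg0 _) (Finset.mem_univ k)
    · rw [if_neg h]
      exact mul_nonneg hD (Finset.sum_nonneg fun k _ => hmaj0 m k)
  have hsumm := Summable.of_nonneg_of_le (fun m => by split_ifs <;> positivity) hle hmaj.summable
  refine ⟨hsumm, (hsumm.tsum_le_tsum hle hmaj.summable).trans ?_⟩
  rw [hmaj.tsum_eq, Finset.sum_const, Finset.card_univ, Fintype.card_fin, nsmul_eq_mul]
  have hexp : (-2 + ε + γ) / 2 = -θ := by rw [hθ_def]; ring
  rw [hexp]
  change D * (((L + 1 : ℕ) : ℝ) * T) ≤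
    A ^ θ * ((L + 1) * T + 1) * N ^ (-γ) * sqBracket n ^ (-θ)
  have : A ^ θ * ((L + 1) * T + 1) * N ^ (-γ) * sqBracket n ^ (-θ) =
      D * (((L + 1 : ℕ) : ℝ) * T) + D := by
    rw [hD_def]
    push_cast
    ring
  rw [this]
  linarith
end
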